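/- If a sequence of integers r_n is defined by ∑_{n≥1} r_n z^{2n}/(2n)! = -log(∑_{n≥0} (-1)^n z^{2n}/(2n)!) as formal power series, then r_n = E_{2n-1}, the number of alternating permutations of [2n-1]. -/

import Mathlib

open PowerSeries

/-- The descent set of a permutation of `[m]`. -/
def desSet {m : ℕ} (σ : Equiv.Perm (Fin m)) : Set ℕ :=
  {i | ∃ h : i < m, 0 < i ∧
    σ ⟨i, h⟩ < σ ⟨i - 1, lt_of_le_of_lt (Nat.sub_le i 1) h⟩}

/-- The number of alternating permutations of `[m]` (descent set `{2,4,...}`). -/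
noncomputable def altEuler (m : ℕ) : ℕ :=
  Nat.card {σ : Equiv.Perm (Fin m) // desSet σ = {i | 0 < i ∧ i < m ∧ 2 ∣ i}}

theorem mem_desSet {m : ℕ} (σ : Equiv.Perm (Fin m)) (i : ℕ) (h : i + 1 < m) :
    i + 1 ∈ desSet σ ↔ σ ⟨i + 1, h⟩ < σ ⟨i, Nat.lt_of_succ_lt h⟩ :=
  ⟨fun ⟨_, _, hlt⟩ => hlt, fun hlt => ⟨h, Nat.succ_pos i, hlt⟩⟩

theorem desSet_eq_iff {m : ℕ} (σ : Equiv.Perm (Fin m)) (P : ℕ → Prop) :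
    desSet σ = {i | 0 < i ∧ i < m ∧ P i} ↔ ∀ i, 0 < i → i < m → (i ∈ desSet σ ↔ P i) := by
  have hbd : ∀ i ∈ desSet σ, 0 < i ∧ i < m := fun i ⟨h, h0, _⟩ => ⟨h0, h⟩
  rw [Set.ext_iff]
  refine forall_congr' fun i => ?_
  have := hbd i
  simp only [Set.mem_ofPred_eq]
  tauto

theorem fin_strictAnti_of_forall_lt {α : Type*} [Preorder α] {q : ℕ} {f : Fin q → α}
    (h : ∀ j (hj : j + 1 < q), f ⟨j + 1, hj⟩ < f ⟨j, Nat.lt_of_succ_lt hj⟩) : StrictAnti f := by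
  cases q with
  | zero => exact fun a => a.elim0
  | succ n =>
    rw [Fin.strictAnti_iff_succ_lt]
    exact fun i => h i (Nat.succ_lt_succ i.isLt)

section Shuffle

variable {p q : ℕ}

theorem card_compl_of_card_eq {S : Finset (Fin (p + q))} (hS : S.card = p) : Sᶜ.card = q := by
  simp [Finset.card_compl, hS]

/-- The permutation whose first `p` values form the set `S`, in the relative order given by `τ`,
and whose last `q` values are decreasing. -/
def shuffle (S : Finset (Fin (p + q))) (hS : S.card = p) (τ : Equiv.Perm (Fin p)) :
    Equiv.Perm (Fin (p + q)) :=
  finSumFinEquiv.symm.trans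
    ((Equiv.sumCongr τ Fin.revPerm).trans (finSumEquivOfFinset hS (card_compl_of_card_eq hS)))

variable {S : Finset (Fin (p + q))} (hS : S.card = p) (τ : Equiv.Perm (Fin p))

theorem shuffle_castAdd (i : Fin p) :
    shuffle S hS τ (Fin.castAdd q i) = S.orderEmbOfFin hS (τ i) := by
  simp [shuffle]

theorem shuffle_natAdd (j : Fin q) :
    shuffle S hS τ (Fin.natAdd p j) =
      Sᶜ.orderEmbOfFin (card_compl_of_card_eq hS) (Fin.rev j) := by
  simp [shuffle]

theorem mem_desSet_shuffle_of_lt {i : ℕ} (hi : i < p) :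
    i ∈ desSet (shuffle S hS τ) ↔ i ∈ desSet τ := by
  cases i with
  | zero => simp [desSet]
  | succ i =>
    rw [mem_desSet _ i (by omega), mem_desSet _ i hi,
      show (⟨i + 1, by omega⟩ : Fin (p + q)) = Fin.castAdd q ⟨i + 1, hi⟩ from rfl,
      show (⟨i, by omega⟩ : Fin (p + q)) = Fin.castAdd q ⟨i, by omega⟩ from rfl,
      shuffle_castAdd, shuffle_castAdd, OrderEmbedding.lt_iff_lt]

theorem mem_desSet_shuffle_of_gt {i : ℕ} (hi : p < i) (hi' : i < p + q) :
    i ∈ desSet (shuffle S hS τ) := by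
  obtain ⟨j, rfl⟩ : ∃ j, i = p + j + 1 := ⟨i - p - 1, by omega⟩
  rw [mem_desSet _ _ hi',
    show (⟨p + j + 1, hi'⟩ : Fin (p + q)) = Fin.natAdd p ⟨j + 1, by omega⟩ from rfl,
    show (⟨p + j, by omega⟩ : Fin (p + q)) = Fin.natAdd p ⟨j, by omega⟩ from rfl,
    shuffle_natAdd, shuffle_natAdd, OrderEmbedding.lt_iff_lt, Fin.rev_lt_rev]
  simp

theorem image_shuffle_castAdd :
    Finset.univ.image (fun i => shuffle S hS τ (Fin.castAdd q i)) = S := by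
  refine Finset.eq_of_subset_of_card_le ?_ ?_
  · intro x hx
    obtain ⟨i, -, rfl⟩ := Finset.mem_image.1 hx
    rw [shuffle_castAdd]
    exact Finset.orderEmbOfFin_mem _ _ _
  · rw [Finset.card_image_of_injective, hS, Finset.card_fin]
    exact (shuffle S hS τ).injective.comp (Fin.castAdd_injective p q)

theorem exists_shuffle_eq (σ : Equiv.Perm (Fin (p + q)))
    (hσ : ∀ i, p < i → i < p + q → i ∈ desSet σ) :
    ∃ (S : Finset (Fin (p + q))) (hS : S.card = p) (τ : Equiv.Perm (Fin p)),
      shuffle S hS τ = σ := by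
  have hinj : Function.Injective fun i => σ (Fin.castAdd q i) :=
    σ.injective.comp (Fin.castAdd_injective p q)
  set S : Finset (Fin (p + q)) := Finset.univ.image fun i => σ (Fin.castAdd q i) with hSdef
  have hS : S.card = p := by rw [hSdef, Finset.card_image_of_injective _ hinj, Finset.card_fin]
  have hmem : ∀ i, σ (Fin.castAdd q i) ∈ S := fun i =>
    Finset.mem_image_of_mem _ (Finset.mem_univ i)
  let t : Fin p → Fin p := fun i => (S.orderIsoOfFin hS).symm ⟨_, hmem i⟩
  have ht : Function.Injective t := fun i j hij =>
    hinj (congrArg Subtype.val ((S.orderIsoOfFin hS).symm.injective hij))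
  refine ⟨S, hS, Equiv.ofBijective t (Finite.injective_iff_bijective.1 ht), ?_⟩
  ext1 x
  induction x using Fin.addCases with
  | left i =>
    rw [shuffle_castAdd, Equiv.ofBijective_apply, ← Finset.coe_orderIsoOfFin_apply]
    simp [t]
  | right j =>
    have hanti : StrictAnti fun j : Fin q => σ (Fin.natAdd p j) :=
      fin_strictAnti_of_forall_lt fun j hj =>
        (mem_desSet σ (p + j) (by omega)).1 (hσ _ (by omega) (by omega))
    have hmono : StrictMono fun j : Fin q => σ (Fin.natAdd p (Fin.rev j)) := fun a b hab =>
      hanti (Fin.rev_lt_rev.2 hab)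
    have hcompl : ∀ j : Fin q, σ (Fin.natAdd p (Fin.rev j)) ∈ Sᶜ := by
      intro j
      simp only [hSdef, Finset.mem_compl, Finset.mem_image, Finset.mem_univ, true_and, not_exists,
        EmbeddingLike.apply_eq_iff_eq, Fin.ext_iff, Fin.val_castAdd, Fin.val_natAdd]
      omega
    rw [shuffle_natAdd, ← Finset.orderEmbOfFin_unique (card_compl_of_card_eq hS) hcompl hmono]
    simp only [Fin.rev_rev]

end Shuffle

theorem ncard_alternating_then_decreasing {p q N : ℕ} (hN : p + q = N) :
    {σ : Equiv.Perm (Fin N) |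
      ∀ i, 0 < i → i < N → i ≠ p → (i ∈ desSet σ ↔ 2 ∣ i ∨ p ≤ i)}.ncard =
      N.choose p * altEuler p := by
  subst hN
  have hcard : Nat.card {S : Finset (Fin (p + q)) // S.card = p} = (p + q).choose p := by
    rw [Nat.card_eq_fintype_card, Fintype.card_finset_len, Fintype.card_fin]
  rw [altEuler, ← hcard, ← Nat.card_prod, ← Nat.card_coe_set_eq]
  symm
  refine Nat.card_eq_of_bijective
    (fun x => ⟨shuffle x.1.1 x.1.2 x.2.1, fun i h0 hi hne => ?_⟩) ⟨?_, ?_⟩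
  · rcases lt_or_gt_of_ne hne with h | h
    · rw [mem_desSet_shuffle_of_lt _ _ h, (desSet_eq_iff _ _).1 x.2.2 i h0 h]
      simp [h]
    · simp [mem_desSet_shuffle_of_gt _ _ h hi, h.le]
  · rintro ⟨⟨S, hS⟩, τ, hτ⟩ ⟨⟨S', hS'⟩, τ', hτ'⟩ h
    have h : shuffle S hS τ = shuffle S' hS' τ' := congrArg Subtype.val h
    obtain rfl : S = S' := by
      rw [← image_shuffle_castAdd hS τ, h, image_shuffle_castAdd]
    obtain rfl : τ = τ' := by
      ext1 i
      have hi := congrArg (fun σ => σ (Fin.castAdd q i)) h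
      simpa only [shuffle_castAdd, EmbeddingLike.apply_eq_iff_eq] using hi
    rfl
  · rintro ⟨σ, hσ⟩
    obtain ⟨S, hS, τ, rfl⟩ := exists_shuffle_eq σ fun i hp hi =>
      (hσ i (by omega) hi hp.ne').2 (Or.inr hp.le)
    refine ⟨⟨⟨S, hS⟩, τ, (desSet_eq_iff _ _).2 fun i h0 hi => ?_⟩, rfl⟩
    rw [← mem_desSet_shuffle_of_lt hS τ hi, hσ i h0 (by omega) hi.ne]
    simp [hi]

/-- The number of permutations of `[N]` that alternate up to step `t` and decrease from there on. -/
noncomputable def altDecCount (N t : ℕ) : ℕ :=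
  {σ : Equiv.Perm (Fin N) | ∀ i, 0 < i → i < N → (i ∈ desSet σ ↔ 2 ∣ i ∨ t ≤ i)}.ncard

theorem altDecCount_self (N : ℕ) : altDecCount N N = altEuler N := by
  rw [altEuler, altDecCount, ← Nat.card_coe_set_eq]
  refine Nat.card_congr (Equiv.subtypeEquivRight fun σ => ?_)
  rw [desSet_eq_iff]
  refine forall_congr' fun i => forall_congr' fun _ => forall_congr' fun hi => ?_
  simp [Nat.not_le.2 hi]

theorem altDecCount_one (N : ℕ) : altDecCount N 1 = 1 := by
  have h0 : altEuler 0 = 1 := by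
    rw [altEuler, Nat.card_eq_one_iff_unique]
    refine ⟨inferInstance, ⟨⟨1, (desSet_eq_iff _ _).2 fun i _ hi => absurd hi (by omega)⟩⟩⟩
  have h := ncard_alternating_then_decreasing (zero_add N)
  rw [h0, Nat.choose_zero_right, one_mul] at h
  refine Eq.trans ?_ h
  unfold altDecCount
  congr 1
  ext σ
  refine forall_congr' fun i => forall_congr' fun h0 => forall_congr' fun _ => ?_
  simp [h0.ne', Nat.one_le_iff_ne_zero]

theorem altDecCount_succ_of_even {N t : ℕ} (ht : 2 ∣ t) :
    altDecCount N t = altDecCount N (t + 1) := by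
  unfold altDecCount
  congr 1
  ext σ
  refine forall_congr' fun i => forall_congr' fun _ => forall_congr' fun _ => ?_
  have : (2 ∣ i ∨ t ≤ i) ↔ (2 ∣ i ∨ t + 1 ≤ i) := by omega
  rw [this]

theorem choose_mul_altEuler {N p : ℕ} (hp : ¬ 2 ∣ p) (hpN : p < N) :
    N.choose p * altEuler p = altDecCount N p + altDecCount N (p + 1) := by
  rw [← ncard_alternating_then_decreasing (Nat.add_sub_of_le hpN.le), altDecCount, altDecCount,
    ← Set.ncard_union_eq _ (Set.toFinite _) (Set.toFinite _)]
  · congr 1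
    ext σ
    simp only [Set.mem_union, Set.mem_ofPred_eq]
    constructor
    · intro h
      by_cases hd : p ∈ desSet σ
      · left
        intro i h0 hi
        rcases eq_or_ne i p with rfl | hne
        · simp [hd]
        · exact h i h0 hi hne
      · right
        intro i h0 hi
        rcases eq_or_ne i p with rfl | hne
        · simp [hd, hp]
        · rw [h i h0 hi hne]
          omega
    · rintro (h | h) i h0 hi hne
      · exact h i h0 hi
      · rw [h i h0 hi]
        omega
  · rw [Set.disjoint_left]
    intro σ h h'
    have h1 := h p (by omega) hpN
    have h2 := h' p (by omega) hpN
    simp [hp] at h1 h2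
    exact h2 h1

theorem sum_range_neg_one_pow_mul_add_succ {R : Type*} [CommRing R] (V : ℕ → R) (m : ℕ) :
    ∑ j ∈ Finset.range m, (-1) ^ j * (V j + V (j + 1)) = V 0 - (-1) ^ m * V m := by
  induction m with
  | zero => simp
  | succ m ih => rw [Finset.sum_range_succ, ih]; ring

theorem sum_choose_mul_altEuler (m : ℕ) :
    ∑ j ∈ Finset.range (m + 1),
      (-1 : ℚ) ^ j * ((2 * m + 1).choose (2 * j + 1) * altEuler (2 * j + 1)) = 1 := by
  have hV : ∀ j ∈ Finset.range m,
      (-1 : ℚ) ^ j * ((2 * m + 1).choose (2 * j + 1) * altEuler (2 * j + 1)) =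
        (-1) ^ j * ((altDecCount (2 * m + 1) (2 * j + 1) : ℚ) +
          altDecCount (2 * m + 1) (2 * (j + 1) + 1)) := by
    intro j hj
    have hj := Finset.mem_range.1 hj
    have h := choose_mul_altEuler (N := 2 * m + 1) (p := 2 * j + 1) (by omega) (by omega)
    rw [altDecCount_succ_of_even (t := 2 * j + 1 + 1) (by omega)] at h
    rw [← Nat.cast_mul, h, Nat.cast_add]
    rfl
  rw [Finset.sum_range_succ, Finset.sum_congr rfl hV,
    sum_range_neg_one_pow_mul_add_succ fun j => (altDecCount (2 * m + 1) (2 * j + 1) : ℚ)]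
  simp [altDecCount_one, altDecCount_self]

theorem sum_range_two_mul {M : Type*} [AddCommMonoid M] (f : ℕ → M) (n : ℕ) :
    ∑ i ∈ Finset.range (2 * n), f i = ∑ j ∈ Finset.range n, (f (2 * j) + f (2 * j + 1)) := by
  induction n with
  | zero => simp
  | succ n ih =>
    rw [Nat.mul_succ, Finset.sum_range_succ, Finset.sum_range_succ, Finset.sum_range_succ, ih,
      add_assoc]

theorem eq_of_sum_choose_mul_eq {x y : ℕ → ℚ}
    (h : ∀ m, ∑ j ∈ Finset.range (m + 1), (-1 : ℚ) ^ j * ((2 * m + 1).choose (2 * j + 1) * x j) =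
      ∑ j ∈ Finset.range (m + 1), (-1 : ℚ) ^ j * ((2 * m + 1).choose (2 * j + 1) * y j)) (m : ℕ) :
    x m = y m := by
  induction m using Nat.strong_induction_on with
  | _ m ih =>
    have hm := h m
    rw [Finset.sum_range_succ, Finset.sum_range_succ,
      Finset.sum_congr rfl fun j hj => by rw [ih j (Finset.mem_range.1 hj)]] at hm
    simpa using hm

/-- If `∑_{n≥1} r_n z^{2n}/(2n)! = -log (∑_{n≥0} (-1)^n z^{2n}/(2n)!)` as formal power
series over `ℚ` (the right-hand side characterized by: the left side `L` has constant
term `0` and satisfies `g * L' = -g'` where `g` is the series being logarithmed), then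
`r_n = E_{2n-1}`, the number of alternating permutations of `[2n-1]`. -/
theorem stmt_2 (r : ℕ → ℚ)
    (L : PowerSeries ℚ)
    (hL : L = PowerSeries.mk fun k =>
      if 2 ∣ k ∧ k ≠ 0 then r (k / 2) / (Nat.factorial k : ℚ) else 0)
    (g : PowerSeries ℚ)
    (hg : g = PowerSeries.mk fun k =>
      if 2 ∣ k then (-1 : ℚ) ^ (k / 2) / (Nat.factorial k : ℚ) else 0)
    (hlog : g * L.derivativeFun = -g.derivativeFun) :
    ∀ n : ℕ, 1 ≤ n → r n = altEuler (2 * n - 1) := by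
  replace hlog : g * derivative ℚ L = -derivative ℚ g := hlog
  have hsum : ∀ m, ∑ j ∈ Finset.range (m + 1),
      (-1 : ℚ) ^ j * ((2 * m + 1).choose (2 * j + 1) * r (j + 1)) = 1 := by
    intro m
    have hc := congrArg (coeff (2 * m + 1)) hlog
    have hodd : ∀ j, ¬ 2 ∣ 2 * j + 1 := by omega
    have hdiv : ∀ j, (2 * j + 1 + 1) / 2 = j + 1 := by omega
    rw [mul_comm g, coeff_mul, Finset.Nat.sum_antidiagonal_eq_sum_range_succ
      (fun a b => coeff a (derivative ℚ L) * coeff b g), Nat.succ_eq_add_one,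
      show 2 * m + 1 + 1 = 2 * (m + 1) by ring, sum_range_two_mul, map_neg,
      coeff_derivative] at hc
    have hterm : ∀ j ∈ Finset.range (m + 1),
        coeff (2 * j) (derivative ℚ L) * coeff (2 * m + 1 - 2 * j) g +
          coeff (2 * j + 1) (derivative ℚ L) * coeff (2 * m + 1 - (2 * j + 1)) g =
        (-1) ^ m / ((2 * m + 1).factorial : ℚ) *
          ((-1 : ℚ) ^ j * ((2 * m + 1).choose (2 * j + 1) * r (j + 1))) := by
      intro j hj
      have hj := Finset.mem_range.1 hj
      obtain ⟨k, rfl⟩ : ∃ k, m = j + k := ⟨m - j, by omega⟩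
      have hfac := Nat.add_choose_mul_factorial_mul_factorial (2 * k) (2 * j + 1)
      rw [show 2 * (j + k) + 1 = 2 * k + (2 * j + 1) by ring, ← hfac]
      have hch : (((2 * k + (2 * j + 1)).choose (2 * j + 1) : ℕ) : ℚ) ≠ 0 :=
        Nat.cast_ne_zero.2 (Nat.choose_pos (by omega)).ne'
      have hsq : (-1 : ℚ) ^ j * (-1) ^ j = 1 := by rw [← mul_pow]; simp
      have hj1 : (2 * (j : ℚ) + 1 + 1) ≠ 0 := by positivity
      rw [coeff_derivative, coeff_derivative, hL, hg]
      simp only [coeff_mk, hodd, hdiv, Nat.add_sub_cancel, Nat.factorial_succ (2 * j + 1),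
        show 2 ∣ 2 * j + 1 + 1 by omega, show 2 ∣ 2 * k by omega, pow_add,
        show 2 * k / 2 = k by omega]
      push_cast
      simp
      field_simp
      linear_combination -r (j + 1) * hsq
    rw [Finset.sum_congr rfl hterm, ← Finset.mul_sum, hg, coeff_mk, if_pos (by omega), hdiv,
      Nat.factorial_succ (2 * m + 1)] at hc
    have hpow : (-1 : ℚ) ^ m ≠ 0 := pow_ne_zero _ (by norm_num)
    have hfac : ((2 * m + 1).factorial : ℚ) ≠ 0 := Nat.cast_ne_zero.2 (Nat.factorial_ne_zero _)
    have hm1 : (2 * (m : ℚ) + 1 + 1) ≠ 0 := by positivity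
    refine mul_left_cancel₀ (div_ne_zero hpow hfac) (hc.trans ?_)
    push_cast
    field_simp
    ring
  intro n hn
  obtain ⟨m, rfl⟩ := Nat.exists_eq_add_of_le' hn
  exact eq_of_sum_choose_mul_eq (x := fun j => r (j + 1)) (y := fun j => altEuler (2 * j + 1))
    (fun m => (hsum m).trans (sum_choose_mul_altEuler m).symm) m
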